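/- arXiv:1302.6251 — 2 statements merged into one kernel-verified Lean document; each statement's English description precedes it below -/
import Mathlib

section
/- (Theorem 1 — Purification, entanglement, and classical correlations) Let S, R, A be nonempty finite types, let ψ ∈ ℂ^{S×R×A} be a unit vector, and set ρ_SR = tr_A |ψ⟩⟨ψ|, ρ_SA = tr_R |ψ⟩⟨ψ|, ρ_S = tr_{RA} |ψ⟩⟨ψ|. Then for every integer d with 1 ≤ d ≤ |S|, ε^(d)(ρ_S) = E^(d)_{S|R}(ρ_SR) + C^(d)_{S|A}(ρ_SA). -/
open Matrix
open scoped ComplexOrder Kronecker Classical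

/-- Sum of the `d` largest eigenvalues (with multiplicity, decreasing order)
of a Hermitian matrix. -/
noncomputable def sumTopEigs {n : Type*} [Fintype n] [DecidableEq n]
    {A : Matrix n n ℂ} (hA : A.IsHermitian) (d : ℕ) : ℝ :=
  ((((Finset.univ.val.map hA.eigenvalues).sort (· ≤ ·)).reverse.take d)).sum

/-- `ε^(d)(A) = 1 - Σ_{i=1}^d λ_i^↓(A)` for Hermitian `A` (junk value `0` otherwise). -/
noncomputable def epsD {n : Type*} [Fintype n] [DecidableEq n]
    (A : Matrix n n ℂ) (d : ℕ) : ℝ :=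
  if h : A.IsHermitian then 1 - sumTopEigs h d else 0

/-- `|ψ⟩⟨ψ|`. -/
noncomputable def outer {n : Type*} (ψ : n → ℂ) : Matrix n n ℂ :=
  fun i j => ψ i * star (ψ j)

/-- Partial trace over the second tensor factor. -/
noncomputable def ptraceR {S R : Type*} [Fintype R] (M : Matrix (S × R) (S × R) ℂ) :
    Matrix S S ℂ :=
  fun s s' => ∑ r, M (s, r) (s', r)

/-- Partial trace over the third tensor factor. -/
noncomputable def ptrace3 {S R A : Type*} [Fintype A] (M : Matrix (S × R × A) (S × R × A) ℂ) :
    Matrix (S × R) (S × R) ℂ :=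
  fun p q => ∑ a, M (p.1, p.2, a) (q.1, q.2, a)

/-- Partial trace over the second (middle) tensor factor. -/
noncomputable def ptrace2 {S R A : Type*} [Fintype R] (M : Matrix (S × R × A) (S × R × A) ℂ) :
    Matrix (S × A) (S × A) ℂ :=
  fun p q => ∑ r, M (p.1, r, p.2) (q.1, r, q.2)

/-- Partial trace over the second and third tensor factors. -/
noncomputable def ptrace23 {S R A : Type*} [Fintype R] [Fintype A]
    (M : Matrix (S × R × A) (S × R × A) ℂ) : Matrix S S ℂ :=
  fun s s' => ∑ r, ∑ a, M (s, r, a) (s', r, a)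

/-- Convex-roof extension `E^(d)_{S|R}`: the infimum over all finite pure-state
convex decompositions `ρ = Σ_k p_k |ψ_k⟩⟨ψ_k|` of `Σ_k p_k ε^(d)(tr_R |ψ_k⟩⟨ψ_k|)`. -/
noncomputable def convRoofE {S R : Type*} [Fintype S] [Fintype R] [DecidableEq S]
    (d : ℕ) (ρ : Matrix (S × R) (S × R) ℂ) : ℝ :=
  sInf { e : ℝ | ∃ (m : ℕ) (p : Fin m → ℝ) (ψ : Fin m → (S × R → ℂ)),
    (∀ k, 0 ≤ p k) ∧ (∑ k, p k = 1) ∧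
    (∀ k, star (ψ k) ⬝ᵥ ψ k = 1) ∧
    (ρ = ∑ k, (p k : ℂ) • outer (ψ k)) ∧
    e = ∑ k, p k * epsD (ptraceR (outer (ψ k))) d }

/-- Classical correlations `C^(d)_{S|A}`:
`ε^(d)(tr_A ρ)` minus the infimum over all POVMs `{M_x}` on `A` of
`Σ_x p_x ε^(d)(p_x⁻¹ tr_A((1_S ⊗ M_x) ρ))`, where `p_x = tr((1_S ⊗ M_x) ρ)`
and terms with `p_x = 0` are omitted. -/
noncomputable def classC {S A : Type*} [Fintype S] [Fintype A] [DecidableEq S] [DecidableEq A]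
    (d : ℕ) (ρ : Matrix (S × A) (S × A) ℂ) : ℝ :=
  epsD (ptraceR ρ) d -
  sInf { e : ℝ | ∃ (m : ℕ) (M : Fin m → Matrix A A ℂ),
    (∀ x, (M x).PosSemidef) ∧ (∑ x, M x = 1) ∧
    e = ∑ x,
      (if (((1 : Matrix S S ℂ) ⊗ₖ M x) * ρ).trace = 0 then 0
       else ((((1 : Matrix S S ℂ) ⊗ₖ M x) * ρ).trace).re *
         epsD (((((1 : Matrix S S ℂ) ⊗ₖ M x) * ρ).trace)⁻¹ •
           ptraceR (((1 : Matrix S S ℂ) ⊗ₖ M x) * ρ)) d) }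

open Finset in
theorem sum_take_reverse_sort_of_antitone {n : Type*} [Fintype n] {m : ℕ} (f : n → ℝ)
    (g : Fin m → ℝ) (hg : Antitone g) (e : n ≃ Fin m) (hf : ∀ i, f i = g (e i)) (d : ℕ) :
    (((univ.val.map f).sort (· ≤ ·)).reverse.take d).sum = ∑ i with (e i).val < d, f i := by
  have hsort : ((univ.val.map f).sort (· ≤ ·)).reverse = List.ofFn g := by
    refine List.Perm.eq_of_sortedGE ?_ hg.sortedGE_ofFn ?_
    · exact (Multiset.pairwise_sort _ _).sortedLE.reverse
    · refine (List.reverse_perm _).trans ?_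
      rw [← Multiset.coe_eq_coe, Multiset.sort_eq]
      have h1 : (univ : Finset n).val.map f = (univ : Finset (Fin m)).val.map g := by
        rw [← Finset.map_univ_equiv e, Finset.map_val, Multiset.map_map]
        exact Multiset.map_congr rfl fun i _ => hf i
      rw [h1, Fin.univ_val_map]
  rw [hsort, List.sum_take_ofFn, Finset.sum_filter, Finset.sum_filter, ← e.sum_comp]
  exact Finset.sum_congr rfl fun i _ => by rw [hf i]

theorem exists_finset_sumTopEigs {n : Type*} [Fintype n] [DecidableEq n] {A : Matrix n n ℂ}
    (hA : A.IsHermitian) {d : ℕ} (hd : d ≤ Fintype.card n) :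
    ∃ T : Finset n, T.card = d ∧ sumTopEigs hA d = ∑ i ∈ T, hA.eigenvalues i ∧
      ∀ i ∈ T, ∀ j ∉ T, hA.eigenvalues j ≤ hA.eigenvalues i := by
  let e : n ≃ Fin (Fintype.card n) := (Fintype.equivOfCardEq (Fintype.card_fin _)).symm
  refine ⟨Finset.univ.filter fun i => (e i).val < d, ?_,
    sum_take_reverse_sort_of_antitone _ _ hA.eigenvalues₀_antitone e (fun _ => rfl) d, ?_⟩
  · rw [Finset.card_filter, e.sum_comp fun i => if i.val < d then 1 else 0,
      ← Finset.card_filter, Fin.card_filter_val_lt, min_eq_right hd]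
  · intro i hi j hj
    simp only [Finset.mem_filter, Finset.mem_univ, true_and, not_lt] at hi hj
    exact hA.eigenvalues₀_antitone (Fin.le_def.2 (hi.le.trans hj))

theorem sum_mul_le_sum_of_threshold {n : Type*} [Fintype n] (f q : n → ℝ)
    (T : Finset n) (hT : T.Nonempty) (h : ∀ i ∈ T, ∀ j ∉ T, f j ≤ f i)
    (hq0 : ∀ i, 0 ≤ q i) (hq1 : ∀ i, q i ≤ 1) (hq : ∑ i, q i = T.card) :
    ∑ i, q i * f i ≤ ∑ i ∈ T, f i := by
  obtain ⟨k, hk, hmin⟩ := T.exists_min_image f hT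
  have hpt : ∀ i, q i * f i ≤ (if i ∈ T then f i else 0) +
      f k * (q i - if i ∈ T then 1 else 0) := by
    intro i
    split_ifs with hi
    · nlinarith [hmin i hi, hq1 i]
    · nlinarith [h k hk i hi, hq0 i]
  refine (Finset.sum_le_sum fun i _ => hpt i).trans (le_of_eq ?_)
  rw [Finset.sum_add_distrib, ← Finset.mul_sum, Finset.sum_sub_distrib, hq]
  simp

/-- Feasible set of the Ky Fan variational problem. -/
def IsKyFanWeight {n : Type*} [Fintype n] [DecidableEq n] (d : ℕ) (P : Matrix n n ℂ) : Prop :=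
  P.PosSemidef ∧ (1 - P).PosSemidef ∧ P.trace = d

theorem re_trace_mul_le_sumTopEigs {n : Type*} [Fintype n] [DecidableEq n] {A : Matrix n n ℂ}
    (hA : A.IsHermitian) {d : ℕ} (hd1 : 1 ≤ d) (hd : d ≤ Fintype.card n) {P : Matrix n n ℂ}
    (hP : IsKyFanWeight d P) : (P * A).trace.re ≤ sumTopEigs hA d := by
  obtain ⟨T, hT, hsum, hle⟩ := exists_finset_sumTopEigs hA hd
  set U : Matrix n n ℂ := (hA.eigenvectorUnitary : Matrix n n ℂ) with hU
  have hUU : U * Uᴴ = 1 := Unitary.coe_mul_star_self hA.eigenvectorUnitary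
  have hUU' : Uᴴ * U = 1 := Unitary.coe_star_mul_self hA.eigenvectorUnitary
  set Q := Uᴴ * P * U with hQ
  have hQ0 : Q.PosSemidef := hP.1.conjTranspose_mul_mul_same U
  have hQ1 : (1 - Q).PosSemidef := by
    have := hP.2.1.conjTranspose_mul_mul_same U
    rwa [Matrix.mul_sub, Matrix.sub_mul, Matrix.mul_one, hUU'] at this
  have htr : Q.trace = d := by
    rw [hQ, Matrix.trace_mul_cycle, hUU, Matrix.one_mul, hP.2.2]
  have hPA : (P * A).trace = (Q * diagonal (RCLike.ofReal ∘ hA.eigenvalues)).trace := by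
    conv_lhs => rw [hA.spectral_theorem, Unitary.conjStarAlgAut_apply]
    rw [← Matrix.mul_assoc, Matrix.trace_mul_comm, hQ]
    simp only [Matrix.mul_assoc]
    rfl
  have hdiag : (P * A).trace.re = ∑ i, (Q i i).re * hA.eigenvalues i := by
    rw [hPA, Matrix.trace, Complex.re_sum]
    refine Finset.sum_congr rfl fun i _ => ?_
    simp [Matrix.mul_diagonal]
  rw [hdiag, hsum]
  refine sum_mul_le_sum_of_threshold _ _ T (Finset.card_pos.1 (by omega)) hle ?_ ?_ ?_
  · intro i
    exact (Complex.nonneg_iff.1 (hQ0.diag_nonneg (i := i))).1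
  · intro i
    have := (Complex.nonneg_iff.1 (hQ1.diag_nonneg (i := i))).1
    simpa using this
  · rw [← Complex.re_sum, hT]
    have := congrArg Complex.re htr
    simpa [Matrix.trace] using this

theorem exists_re_trace_mul_eq_sumTopEigs {n : Type*} [Fintype n] [DecidableEq n]
    {A : Matrix n n ℂ} (hA : A.IsHermitian) {d : ℕ} (hd : d ≤ Fintype.card n) :
    ∃ P : Matrix n n ℂ, IsKyFanWeight d P ∧ (P * A).trace.re = sumTopEigs hA d := by
  obtain ⟨T, hT, hsum, -⟩ := exists_finset_sumTopEigs hA hd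
  set U : Matrix n n ℂ := (hA.eigenvectorUnitary : Matrix n n ℂ) with hU
  have hUU : U * Uᴴ = 1 := Unitary.coe_mul_star_self hA.eigenvectorUnitary
  have hUU' : Uᴴ * U = 1 := Unitary.coe_star_mul_self hA.eigenvectorUnitary
  let t : n → ℂ := fun i => if i ∈ T then 1 else 0
  refine ⟨U * diagonal t * Uᴴ, ⟨?_, ?_, ?_⟩, ?_⟩
  · refine PosSemidef.mul_mul_conjTranspose_same (PosSemidef.diagonal fun i => ?_) U
    by_cases hi : i ∈ T <;> simp [t, hi]
  · have h : (1 : Matrix n n ℂ) - U * diagonal t * Uᴴ = U * diagonal (1 - t) * Uᴴ := by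
      have ht : diagonal (1 - t) = 1 - diagonal t := by
        rw [← Matrix.diagonal_one, Matrix.diagonal_sub]
        rfl
      rw [ht, Matrix.mul_sub, Matrix.sub_mul, Matrix.mul_one, hUU]
    rw [h]
    refine PosSemidef.mul_mul_conjTranspose_same (PosSemidef.diagonal fun i => ?_) U
    by_cases hi : i ∈ T <;> simp [t, hi]
  · rw [Matrix.trace_mul_cycle, hUU', Matrix.one_mul, Matrix.trace_diagonal]
    simp [t, hT]
  · have hPA : (U * diagonal t * Uᴴ * A).trace =
        (diagonal t * diagonal (RCLike.ofReal ∘ hA.eigenvalues)).trace := by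
      conv_lhs => rw [hA.spectral_theorem, Unitary.conjStarAlgAut_apply]
      change (U * diagonal t * Uᴴ * (U * _ * Uᴴ)).trace = _
      have : ∀ D : Matrix n n ℂ, U * diagonal t * Uᴴ * (U * D * Uᴴ) =
          U * (diagonal t * (Uᴴ * U) * D) * Uᴴ := fun D => by simp only [Matrix.mul_assoc]
      rw [this, hUU', Matrix.mul_one, Matrix.trace_mul_cycle, hUU', Matrix.one_mul]
    rw [hPA, hsum, Matrix.diagonal_mul_diagonal, Matrix.trace_diagonal, Complex.re_sum]
    simp [t, ite_mul, apply_ite]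

/-- The homogeneous extension `tr A - Σ_{i ≤ d} λ_i^↓(A)` of `ε^(d)` to Hermitian matrices of
arbitrary trace. -/
noncomputable def traceGap {n : Type*} [Fintype n] [DecidableEq n] (d : ℕ)
    (A : Matrix n n ℂ) : ℝ :=
  A.trace.re - 1 + epsD A d

section TraceGap

variable {n : Type*} [Fintype n] [DecidableEq n] {A : Matrix n n ℂ} {d : ℕ}

theorem traceGap_eq (hA : A.IsHermitian) (d : ℕ) :
    traceGap d A = A.trace.re - sumTopEigs hA d := by
  rw [traceGap, epsD, dif_pos hA]
  ring

theorem traceGap_of_trace_eq_one (hA : A.trace = 1) (d : ℕ) : traceGap d A = epsD A d := by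
  simp [traceGap, hA]

theorem traceGap_le (hA : A.IsHermitian) (hd1 : 1 ≤ d) (hd : d ≤ Fintype.card n)
    {P : Matrix n n ℂ} (hP : IsKyFanWeight d P) :
    traceGap d A ≤ A.trace.re - (P * A).trace.re := by
  rw [traceGap_eq hA]
  linarith [re_trace_mul_le_sumTopEigs hA hd1 hd hP]

theorem exists_traceGap_eq (hA : A.IsHermitian) (hd : d ≤ Fintype.card n) :
    ∃ P : Matrix n n ℂ, IsKyFanWeight d P ∧ traceGap d A = A.trace.re - (P * A).trace.re := by
  obtain ⟨P, hP, h⟩ := exists_re_trace_mul_eq_sumTopEigs hA hd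
  exact ⟨P, hP, by rw [traceGap_eq hA, h]⟩

theorem traceGap_smul (hA : A.IsHermitian) (hd1 : 1 ≤ d) (hd : d ≤ Fintype.card n) {c : ℝ}
    (hc : 0 ≤ c) : traceGap d ((c : ℂ) • A) = c * traceGap d A := by
  have hcA : ((c : ℂ) • A).IsHermitian := by
    rw [IsHermitian, conjTranspose_smul, hA.eq]
    simp
  apply le_antisymm
  · obtain ⟨P, hP, h⟩ := exists_traceGap_eq hA hd
    refine (traceGap_le hcA hd1 hd hP).trans (le_of_eq ?_)
    rw [h]
    simp [mul_sub]
  · obtain ⟨P, hP, h⟩ := exists_traceGap_eq hcA hd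
    rw [h]
    refine (mul_le_mul_of_nonneg_left (traceGap_le hA hd1 hd hP) hc).trans (le_of_eq ?_)
    simp [mul_sub]

theorem sum_traceGap_le {ι : Type*} (s : Finset ι) {B : ι → Matrix n n ℂ}
    (hB : ∀ i, (B i).IsHermitian) (hd1 : 1 ≤ d) (hd : d ≤ Fintype.card n) :
    ∑ i ∈ s, traceGap d (B i) ≤ traceGap d (∑ i ∈ s, B i) := by
  have hsum : (∑ i ∈ s, B i).IsHermitian := by
    rw [IsHermitian, conjTranspose_sum]
    exact Finset.sum_congr rfl fun i _ => (hB i).eq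
  obtain ⟨P, hP, h⟩ := exists_traceGap_eq hsum hd
  rw [h]
  refine (Finset.sum_le_sum fun i _ => traceGap_le (hB i) hd1 hd hP).trans (le_of_eq ?_)
  simp [Matrix.mul_sum, Matrix.trace_sum]

/-- The contribution of a POVM outcome with unnormalized post-measurement state `A`. -/
theorem ite_trace_eq_traceGap (hA : A.PosSemidef) (hd1 : 1 ≤ d) (hd : d ≤ Fintype.card n) :
    (if A.trace = 0 then 0 else A.trace.re * epsD (A.trace⁻¹ • A) d) = traceGap d A := by
  split_ifs with h
  · rw [hA.trace_eq_zero_iff.1 h]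
    simpa using (traceGap_smul (A := (0 : Matrix n n ℂ)) isHermitian_zero hd1 hd le_rfl).symm
  · obtain ⟨hre, him⟩ := Complex.nonneg_iff.1 hA.trace_nonneg
    have hτ : A.trace = (A.trace.re : ℂ) := Complex.ext rfl (by simpa using him.symm)
    have hne : A.trace.re ≠ 0 := fun h0 => h (by rw [hτ, h0, Complex.ofReal_zero])
    have htr : (A.trace⁻¹ • A).trace = 1 := by
      rw [Matrix.trace_smul, smul_eq_mul, inv_mul_cancel₀ h]
    have hinv : A.trace⁻¹ = ((A.trace.re⁻¹ : ℝ) : ℂ) := by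
      rw [Complex.ofReal_inv, ← hτ]
    rw [← traceGap_of_trace_eq_one htr, hinv,
      traceGap_smul hA.isHermitian hd1 hd (inv_nonneg.2 hre), mul_inv_cancel_left₀ hne]

end TraceGap

section PseudoInverse

variable {m n k : Type*} [Fintype m] [Fintype n] [Fintype k]
  [DecidableEq m] [DecidableEq n]

theorem exists_hermitian_pseudoinverse {G : Matrix n n ℂ} (hG : G.IsHermitian) :
    ∃ X : Matrix n n ℂ, X.IsHermitian ∧ G * X * G = G ∧ X * G * X = X := by
  let f : n → ℂ := RCLike.ofReal ∘ hG.eigenvalues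
  set U : Matrix n n ℂ := (hG.eigenvectorUnitary : Matrix n n ℂ)
  have hUU' : Uᴴ * U = 1 := Unitary.coe_star_mul_self hG.eigenvectorUnitary
  have hGU : G = U * diagonal f * Uᴴ := by
    conv_lhs => rw [hG.spectral_theorem, Unitary.conjStarAlgAut_apply]
    rfl
  have hmul : ∀ D E : Matrix n n ℂ, U * D * Uᴴ * (U * E * Uᴴ) = U * (D * E) * Uᴴ := by
    intro D E
    calc U * D * Uᴴ * (U * E * Uᴴ) = U * (D * (Uᴴ * U) * E) * Uᴴ := by
          simp only [Matrix.mul_assoc]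
      _ = _ := by rw [hUU', Matrix.mul_one]
  refine ⟨U * diagonal f⁻¹ * Uᴴ, ?_, ?_, ?_⟩
  · refine isHermitian_mul_mul_conjTranspose U ?_
    refine isHermitian_diagonal_iff.2 fun i => ?_
    simp [f, IsSelfAdjoint]
  · rw [hGU, hmul, hmul, diagonal_mul_diagonal, diagonal_mul_diagonal]
    congr 3
    funext i
    exact mul_inv_mul_cancel (f i)
  · rw [hGU, hmul, hmul, diagonal_mul_diagonal, diagonal_mul_diagonal]
    congr 3
    funext i
    simpa using mul_inv_mul_cancel (f i)⁻¹

/-- Matrices with the same Gram matrix are related by a contraction. -/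
theorem exists_contraction_of_mul_conjTranspose_eq {Ψ : Matrix n m ℂ} {Φ : Matrix n k ℂ}
    (h : Ψ * Ψᴴ = Φ * Φᴴ) :
    ∃ W : Matrix m k ℂ, Ψ * W = Φ ∧ (1 - W * Wᴴ).PosSemidef := by
  obtain ⟨X, hX, hGXG, hXGX⟩ :=
    exists_hermitian_pseudoinverse (isHermitian_mul_conjTranspose_self Ψ)
  set G := Ψ * Ψᴴ with hG
  refine ⟨Ψᴴ * X * Φ, ?_, ?_⟩
  · have hzero : (1 - G * X) * Φ = 0 := by
      rw [← self_mul_conjTranspose_eq_zero, conjTranspose_mul,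
        show (1 - G * X) * Φ * (Φᴴ * (1 - G * X)ᴴ) = (1 - G * X) * (Φ * Φᴴ) * (1 - G * X)ᴴ by
          simp only [Matrix.mul_assoc], ← h, Matrix.sub_mul, hGXG, Matrix.one_mul, sub_self,
        Matrix.zero_mul]
    rw [Matrix.sub_mul, Matrix.one_mul, sub_eq_zero] at hzero
    rw [← Matrix.mul_assoc, ← Matrix.mul_assoc, ← hG, ← hzero]
  · set Q := Ψᴴ * X * Ψ with hQ
    have hQh : Qᴴ = Q := (isHermitian_conjTranspose_mul_mul Ψ hX).eq
    have hQQ : Q * Q = Q := by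
      calc Q * Q = Ψᴴ * (X * (Ψ * Ψᴴ) * X) * Ψ := by simp only [hQ, Matrix.mul_assoc]
        _ = Q := by rw [← hG, hXGX]
    have hW : Ψᴴ * X * Φ * (Ψᴴ * X * Φ)ᴴ = Q := by
      calc Ψᴴ * X * Φ * (Ψᴴ * X * Φ)ᴴ = Ψᴴ * (X * (Φ * Φᴴ) * X) * Ψ := by
            simp only [conjTranspose_mul, conjTranspose_conjTranspose, hX.eq, Matrix.mul_assoc]
        _ = Q := by rw [← h, hXGX]
    have hproj : (1 - Q) * (1 - Q)ᴴ = 1 - Q := by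
      rw [conjTranspose_sub, conjTranspose_one, hQh]
      simp [Matrix.sub_mul, Matrix.mul_sub, hQQ]
    rw [hW, ← hproj]
    exact posSemidef_self_mul_conjTranspose _

end PseudoInverse

section Outer

variable {n k : Type*}

open scoped MatrixOrder in
theorem exists_eq_mul_conjTranspose [Fintype n] [DecidableEq n] {M : Matrix n n ℂ}
    (hM : M.PosSemidef) :
    ∃ B : Matrix n n ℂ, M = B * Bᴴ :=
  CStarAlgebra.nonneg_iff_eq_mul_star_self.1 hM.nonneg

theorem outer_smul (c : ℂ) (φ : n → ℂ) : outer (c • φ) = (c * star c) • outer φ := by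
  ext i j
  simp only [outer, Pi.smul_apply, smul_eq_mul, star_mul', Matrix.smul_apply]
  ring

theorem outer_sqrt_smul {p : ℝ} (hp : 0 ≤ p) (φ : n → ℂ) :
    outer (((√p : ℝ) : ℂ) • φ) = (p : ℂ) • outer φ := by
  rw [outer_smul, Complex.star_def, Complex.conj_ofReal, ← Complex.ofReal_mul,
    Real.mul_self_sqrt hp]

theorem sum_outer_col [Fintype k] (B : Matrix n k ℂ) :
    ∑ j, outer (fun i => B i j) = B * Bᴴ := by
  ext i i'
  simp [outer, Matrix.sum_apply, Matrix.mul_apply]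

variable [Fintype n]

theorem trace_outer (φ : n → ℂ) : (outer φ).trace = star φ ⬝ᵥ φ := by
  simp [outer, Matrix.trace, dotProduct, mul_comm]

theorem posSemidef_outer (φ : n → ℂ) : (outer φ).PosSemidef :=
  posSemidef_vecMulVec_self_star φ

theorem exists_unit_smul_outer_eq [Nonempty n] (φ : n → ℂ) :
    ∃ (p : ℝ) (u : n → ℂ), 0 ≤ p ∧ star u ⬝ᵥ u = 1 ∧ (p : ℂ) • outer u = outer φ := by
  classical
  obtain ⟨hre, him⟩ := Complex.nonneg_iff.1 (posSemidef_outer φ).trace_nonneg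
  have hτ : (outer φ).trace = ((outer φ).trace.re : ℂ) := Complex.ext rfl (by simpa using him.symm)
  set p := (outer φ).trace.re
  by_cases hp : p = 0
  · refine ⟨0, Pi.single (Classical.arbitrary n) 1, le_rfl, by simp, ?_⟩
    rw [hp, Complex.ofReal_zero, (posSemidef_outer φ).trace_eq_zero_iff] at hτ
    rw [hτ, Complex.ofReal_zero, zero_smul]
  · have hu : outer (((√p⁻¹ : ℝ) : ℂ) • φ) = ((p⁻¹ : ℝ) : ℂ) • outer φ :=
      outer_sqrt_smul (inv_nonneg.2 hre) φ
    refine ⟨p, ((√p⁻¹ : ℝ) : ℂ) • φ, hre, ?_, ?_⟩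
    · rw [← trace_outer, hu, Matrix.trace_smul, hτ, smul_eq_mul, ← Complex.ofReal_mul,
        inv_mul_cancel₀ hp, Complex.ofReal_one]
    · rw [hu, smul_smul, ← Complex.ofReal_mul, mul_inv_cancel₀ hp, Complex.ofReal_one, one_smul]

end Outer

section PartialTrace

variable {S R A : Type*}

/-- A tripartite vector as a matrix from the third factor to the first two. -/
def flatten (ψ : S × R × A → ℂ) : Matrix (S × R) A ℂ :=
  fun p a => ψ (p.1, p.2, a)

theorem ptrace3_outer [Fintype A] (ψ : S × R × A → ℂ) :
    ptrace3 (outer ψ) = flatten ψ * (flatten ψ)ᴴ := by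
  ext p q
  simp [ptrace3, outer, flatten, Matrix.mul_apply]

variable [Fintype R]

theorem trace_ptraceR [Fintype S] (M : Matrix (S × R) (S × R) ℂ) :
    (ptraceR M).trace = M.trace := by
  simp [ptraceR, Matrix.trace, Fintype.sum_prod_type]

theorem ptraceR_sum {ι : Type*} (s : Finset ι) (M : ι → Matrix (S × R) (S × R) ℂ) :
    ptraceR (∑ i ∈ s, M i) = ∑ i ∈ s, ptraceR (M i) := by
  ext a b
  simp only [ptraceR, Matrix.sum_apply]
  exact Finset.sum_comm

theorem ptraceR_smul (c : ℂ) (M : Matrix (S × R) (S × R) ℂ) :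
    ptraceR (c • M) = c • ptraceR M := by
  ext a b
  simp [ptraceR, Finset.mul_sum]

theorem posSemidef_ptraceR {M : Matrix (S × R) (S × R) ℂ} (hM : M.PosSemidef) :
    (ptraceR M).PosSemidef := by
  have h : ptraceR M = ∑ r, M.submatrix (fun s => (s, r)) fun s => (s, r) := by
    ext a b
    simp [ptraceR, Matrix.sum_apply]
  rw [h]
  exact posSemidef_sum _ fun r _ => hM.submatrix _

theorem trace_flatten_mul [Fintype S] [Fintype A] {ψ : S × R × A → ℂ}
    (hψ : star ψ ⬝ᵥ ψ = 1) : (flatten ψ * (flatten ψ)ᴴ).trace = 1 := by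
  rw [← hψ]
  simp [flatten, Matrix.trace, Matrix.mul_apply, dotProduct, Fintype.sum_prod_type, mul_comm]

theorem ptraceR_ptrace2_outer [Fintype A] (ψ : S × R × A → ℂ) :
    ptraceR (ptrace2 (outer ψ)) = ptrace23 (outer ψ) := by
  ext s s'
  simp only [ptraceR, ptrace2, ptrace23]
  exact Finset.sum_comm

/-- The unnormalized state of `S` after outcome `M` on `A` is the one obtained by steering `SR`. -/
theorem ptraceR_kronecker_mul_ptrace2_outer [Fintype S] [Fintype A] [DecidableEq S]
    (ψ : S × R × A → ℂ) (M : Matrix A A ℂ) :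
    ptraceR (((1 : Matrix S S ℂ) ⊗ₖ M) * ptrace2 (outer ψ)) =
      ptraceR (flatten ψ * Mᵀ * (flatten ψ)ᴴ) := by
  ext s s'
  simp only [ptraceR, ptrace2, outer, flatten, Matrix.mul_apply, Fintype.sum_prod_type,
    kroneckerMap_apply, Matrix.one_apply, transpose_apply, conjTranspose_apply, ite_mul, one_mul,
    zero_mul, Finset.sum_ite_irrel, Finset.sum_const_zero, Finset.sum_ite_eq, Finset.mem_univ,
    if_true, Finset.mul_sum, Finset.sum_mul]
  rw [Finset.sum_congr rfl fun a _ => Finset.sum_comm, Finset.sum_comm]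
  refine Finset.sum_congr rfl fun r _ => Finset.sum_congr rfl fun a _ =>
    Finset.sum_congr rfl fun b _ => ?_
  ring

end PartialTrace

section Steering

variable {S R A : Type*} [Fintype S] [Fintype R] [DecidableEq S] {d : ℕ}

theorem exists_decomposition_of_sum_outer [Nonempty S] [Nonempty R] {ι : Type*} [Fintype ι]
    (hd1 : 1 ≤ d) (hd : d ≤ Fintype.card S) {ρ : Matrix (S × R) (S × R) ℂ} (hρ : ρ.trace = 1)
    {φ : ι → S × R → ℂ} (hφ : ∑ i, outer (φ i) = ρ) :
    ∃ (m : ℕ) (p : Fin m → ℝ) (u : Fin m → (S × R → ℂ)),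
      (∀ k, 0 ≤ p k) ∧ (∑ k, p k = 1) ∧ (∀ k, star (u k) ⬝ᵥ u k = 1) ∧
      (ρ = ∑ k, (p k : ℂ) • outer (u k)) ∧
      ∑ i, traceGap d (ptraceR (outer (φ i))) =
        ∑ k, p k * epsD (ptraceR (outer (u k))) d := by
  choose p u hp hu hpu using fun i => exists_unit_smul_outer_eq (φ i)
  let e := (Fintype.equivFin ι).symm
  have hsum : ρ = ∑ i, (p i : ℂ) • outer (u i) := by simp only [hpu, hφ]
  refine ⟨Fintype.card ι, p ∘ e, u ∘ e, fun k => hp _, ?_, fun k => hu _, ?_, ?_⟩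
  · have h := congrArg Matrix.trace hsum
    simp only [hρ, Matrix.trace_sum, Matrix.trace_smul, trace_outer, hu, smul_eq_mul,
      mul_one] at h
    rw [show ∑ k, (p ∘ e) k = ∑ i, p i from e.sum_comp p]
    exact_mod_cast h.symm
  · rw [hsum]
    exact (e.sum_comp fun i => (p i : ℂ) • outer (u i)).symm
  · refine Eq.trans (Finset.sum_congr rfl fun i _ => ?_)
      (e.sum_comp fun i => p i * epsD (ptraceR (outer (u i))) d).symm
    rw [← hpu, ptraceR_smul,
      traceGap_smul (posSemidef_ptraceR (posSemidef_outer _)).isHermitian hd1 hd (hp i),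
      traceGap_of_trace_eq_one (by rw [trace_ptraceR, trace_outer, hu])]

variable [Fintype A]

theorem povm_term_eq_traceGap (hd1 : 1 ≤ d) (hd : d ≤ Fintype.card S) (ψ : S × R × A → ℂ)
    {M : Matrix A A ℂ} (hM : M.PosSemidef) :
    (if (((1 : Matrix S S ℂ) ⊗ₖ M) * ptrace2 (outer ψ)).trace = 0 then 0
      else ((((1 : Matrix S S ℂ) ⊗ₖ M) * ptrace2 (outer ψ)).trace).re *
        epsD (((((1 : Matrix S S ℂ) ⊗ₖ M) * ptrace2 (outer ψ)).trace)⁻¹ •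
          ptraceR (((1 : Matrix S S ℂ) ⊗ₖ M) * ptrace2 (outer ψ))) d) =
      traceGap d (ptraceR (flatten ψ * Mᵀ * (flatten ψ)ᴴ)) := by
  rw [← trace_ptraceR, ptraceR_kronecker_mul_ptrace2_outer]
  exact ite_trace_eq_traceGap
    (posSemidef_ptraceR (hM.transpose.mul_mul_conjTranspose_same _)) hd1 hd

theorem exists_decomposition_le_povm [DecidableEq A] [Nonempty S] [Nonempty R] (hd1 : 1 ≤ d)
    (hd : d ≤ Fintype.card S) {ψ : S × R × A → ℂ} {m : ℕ} {M : Fin m → Matrix A A ℂ}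
    (hM : ∀ x, (M x).PosSemidef) (hM1 : ∑ x, M x = 1) :
    ∃ φ : Fin m × A → S × R → ℂ, ∑ i, outer (φ i) = flatten ψ * (flatten ψ)ᴴ ∧
      ∑ i, traceGap d (ptraceR (outer (φ i))) ≤
        ∑ x, traceGap d (ptraceR (flatten ψ * (M x)ᵀ * (flatten ψ)ᴴ)) := by
  choose B hB using fun x => exists_eq_mul_conjTranspose (hM x).transpose
  have hcol : ∀ x, ∑ j, outer (fun p => (flatten ψ * B x) p j) =
      flatten ψ * (M x)ᵀ * (flatten ψ)ᴴ := fun x => by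
    rw [sum_outer_col, hB, conjTranspose_mul]
    simp only [Matrix.mul_assoc]
  refine ⟨fun i p => (flatten ψ * B i.1) p i.2, ?_, ?_⟩
  · rw [Fintype.sum_prod_type]
    simp only [hcol]
    rw [← Matrix.sum_mul, ← Matrix.mul_sum, ← transpose_sum, hM1, transpose_one, Matrix.mul_one]
  · rw [Fintype.sum_prod_type]
    refine Finset.sum_le_sum fun x _ => ?_
    rw [← hcol, ptraceR_sum]
    exact sum_traceGap_le _
      (fun j => (posSemidef_ptraceR (posSemidef_outer _)).isHermitian) hd1 hd

theorem exists_povm_eq_decomposition [DecidableEq A] [DecidableEq R] (hd1 : 1 ≤ d)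
    (hd : d ≤ Fintype.card S) {ψ : S × R × A → ℂ} {m : ℕ} {p : Fin m → ℝ}
    {u : Fin m → S × R → ℂ} (hp : ∀ k, 0 ≤ p k) (hu : ∀ k, star (u k) ⬝ᵥ u k = 1)
    (h : flatten ψ * (flatten ψ)ᴴ = ∑ k, (p k : ℂ) • outer (u k)) :
    ∃ M : Fin (m + 1) → Matrix A A ℂ, (∀ x, (M x).PosSemidef) ∧ ∑ x, M x = 1 ∧
      ∑ x, traceGap d (ptraceR (flatten ψ * (M x)ᵀ * (flatten ψ)ᴴ)) =
        ∑ k, p k * epsD (ptraceR (outer (u k))) d := by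
  set Ψ := flatten ψ with hΨ
  let Φ : Matrix (S × R) (Fin m) ℂ := fun i k => ((√(p k) : ℝ) : ℂ) * u k i
  have hcol : ∀ k, outer (fun i => Φ i k) = (p k : ℂ) • outer (u k) :=
    fun k => outer_sqrt_smul (hp k) (u k)
  have hΦ : Ψ * Ψᴴ = Φ * Φᴴ := by rw [h, ← sum_outer_col, Finset.sum_congr rfl fun k _ => hcol k]
  obtain ⟨W, hW, hW1⟩ := exists_contraction_of_mul_conjTranspose_eq hΦ
  let N : Fin (m + 1) → Matrix A A ℂ :=
    Fin.cons (1 - W * Wᴴ) fun k => outer fun a => W a k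
  have hN0 : Ψ * (1 - W * Wᴴ) * Ψᴴ = 0 := by
    rw [Matrix.mul_sub, Matrix.sub_mul, Matrix.mul_one, hΦ, ← hW, conjTranspose_mul, sub_eq_zero]
    simp only [Matrix.mul_assoc]
  have hNk : ∀ k, Ψ * outer (fun a => W a k) * Ψᴴ = (p k : ℂ) • outer (u k) := by
    intro k
    rw [← hcol, ← hW]
    change Ψ * vecMulVec (fun a => W a k) (star fun a => W a k) * Ψᴴ =
      vecMulVec (Ψ *ᵥ fun a => W a k) (star (Ψ *ᵥ fun a => W a k))
    rw [mul_vecMulVec, vecMulVec_mul, star_mulVec]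
  refine ⟨fun x => (N x)ᵀ, ?_, ?_, ?_⟩
  · intro x
    refine PosSemidef.transpose ?_
    induction x using Fin.cases with
    | zero => exact hW1
    | succ k => exact posSemidef_outer _
  · rw [← transpose_sum, Fin.sum_univ_succ]
    simp only [N, Fin.cons_zero, Fin.cons_succ]
    rw [sum_outer_col, sub_add_cancel, transpose_one]
  · rw [Fin.sum_univ_succ]
    simp only [N, Fin.cons_zero, Fin.cons_succ, transpose_transpose, hN0, hNk, ptraceR_smul]
    have hzero : traceGap d (ptraceR (0 : Matrix (S × R) (S × R) ℂ)) = 0 := by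
      have hz := traceGap_smul (A := ptraceR (0 : Matrix (S × R) (S × R) ℂ))
        (posSemidef_ptraceR .zero).isHermitian hd1 hd le_rfl
      rwa [← ptraceR_smul, smul_zero, zero_mul] at hz
    rw [hzero, zero_add]
    refine Finset.sum_congr rfl fun k _ => ?_
    rw [traceGap_smul (posSemidef_ptraceR (posSemidef_outer _)).isHermitian hd1 hd (hp k),
      traceGap_of_trace_eq_one (by rw [trace_ptraceR, trace_outer, hu])]

end Steering

/-- Theorem 1 — Purification, entanglement, and classical correlations:
for a unit vector `ψ ∈ ℂ^{S×R×A}` with reduced states `ρ_SR = tr_A |ψ⟩⟨ψ|`,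
`ρ_SA = tr_R |ψ⟩⟨ψ|`, `ρ_S = tr_{RA} |ψ⟩⟨ψ|`, and any `1 ≤ d ≤ |S|`,
`ε^(d)(ρ_S) = E^(d)_{S|R}(ρ_SR) + C^(d)_{S|A}(ρ_SA)`. -/
theorem stmt3 {S R A : Type*} [Fintype S] [Fintype R] [Fintype A]
    [DecidableEq S] [DecidableEq R] [DecidableEq A]
    [Nonempty S] [Nonempty R] [Nonempty A]
    (ψ : S × R × A → ℂ) (hψ : star ψ ⬝ᵥ ψ = 1)
    (d : ℕ) (hd1 : 1 ≤ d) (hdn : d ≤ Fintype.card S) :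
    epsD (ptrace23 (outer ψ)) d =
      convRoofE d (ptrace3 (outer ψ)) + classC d (ptrace2 (outer ψ)) := by
  rw [classC, ptraceR_ptrace2_outer, eq_comm, add_sub_left_comm, add_eq_left, sub_eq_zero,
    convRoofE, ptrace3_outer]
  refine csInf_eq_csInf_of_forall_exists_le ?_ ?_
  · rintro _ ⟨m, p, u, hp, -, hu, h, rfl⟩
    obtain ⟨M, hM, hM1, he⟩ := exists_povm_eq_decomposition hd1 hdn hp hu h
    refine ⟨_, ⟨m + 1, M, hM, hM1, rfl⟩, le_of_eq ?_⟩
    rw [← he]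
    exact Finset.sum_congr rfl fun x _ => povm_term_eq_traceGap hd1 hdn ψ (hM x)
  · rintro _ ⟨m, M, hM, hM1, rfl⟩
    obtain ⟨φ, hφ, hle⟩ := exists_decomposition_le_povm (ψ := ψ) hd1 hdn hM hM1
    obtain ⟨k, p, u, hp, hp1, hu, h, he⟩ :=
      exists_decomposition_of_sum_outer hd1 hdn (trace_flatten_mul hψ) hφ
    refine ⟨_, ⟨k, p, u, hp, hp1, hu, h, rfl⟩, ?_⟩
    rw [← he]
    refine hle.trans (le_of_eq ?_)
    exact Finset.sum_congr rfl fun x _ => (povm_term_eq_traceGap hd1 hdn ψ (hM x)).symm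
end

section
/- Let S, R be nonempty finite types, let ρ be a density matrix indexed by (S×R)×(S×R), and let 1 ≤ d ≤ |S|. Then E^(d)_{S|R}(ρ) ≤ ε^(d)(tr_R ρ). -/
open Matrix
open scoped ComplexOrder Kronecker Classical

/-- The `d` largest values of a finite real family are attained on a finset of size `d`. -/
theorem exists_top_finset {n : Type*} [Fintype n] (f : n → ℝ) {d : ℕ}
    (hd : d ≤ Fintype.card n) :
    ∃ T : Finset n, T.card = d ∧
      ∑ i ∈ T, f i = (((Finset.univ.val.map f).sort (· ≤ ·)).reverse.take d).sum ∧
      ∀ i ∈ T, ∀ j ∉ T, f j ≤ f i := by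
  set L : List n := (Finset.univ : Finset n).toList.mergeSort (fun a b => decide (f b ≤ f a))
   
  have hperm : L.Perm (Finset.univ : Finset n).toList := List.mergeSort_perm _ _
  have hnd : L.Nodup := hperm.nodup_iff.mpr (Finset.nodup_toList _)
  have hmem (a : n) : a ∈ L := hperm.mem_iff.mpr (by simp)
  have hlen : L.length = Fintype.card n := by
    rw [hperm.length_eq, Finset.length_toList, Finset.card_univ]
  have hpw : L.Pairwise (fun a b => f b ≤ f a) := by
    have h := List.pairwise_mergeSort (le := fun a b => decide (f b ≤ f a))
      (fun a b c hab hbc => by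
        simp only [decide_eq_true_eq] at *
        exact hbc.trans hab)
      (fun a b => by simpa using le_total _ _) (Finset.univ : Finset n).toList
    simpa using h
  have hmap : L.map f = ((Finset.univ.val.map f).sort (· ≤ ·)).reverse := by
    refine List.Perm.eq_of_pairwise (le := fun a b : ℝ => b ≤ a)
      (fun a b _ _ h₁ h₂ => le_antisymm h₂ h₁) ?_ ?_ ?_
    · simpa [List.pairwise_map] using hpw
    · rw [List.pairwise_reverse]
      exact Multiset.pairwise_sort _ _
    · refine List.Perm.trans ?_ (List.reverse_perm _).symm
      rw [← Multiset.coe_eq_coe, Multiset.sort_eq, ← Multiset.map_coe,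
        Multiset.coe_eq_coe.mpr hperm, Finset.coe_toList]
  have hndt : (L.take d).Nodup := hnd.sublist (List.take_sublist _ _)
  refine ⟨(L.take d).toFinset, ?_, ?_, ?_⟩
  · rw [List.toFinset_card_of_nodup hndt, List.length_take, hlen, min_eq_left hd]
  · rw [List.sum_toFinset _ hndt, ← hmap, List.map_take]
  · intro i hi j hj
    rw [List.mem_toFinset] at hi hj
    have hj' : j ∈ L.drop d := by
      have := hmem j
      rw [← List.take_append_drop d L, List.mem_append] at this
      exact this.resolve_left hj
    rw [← List.take_append_drop d L, List.pairwise_append] at hpw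
    exact hpw.2.2 i hi j hj'

/-- A weighted sum with weights in `[0, 1]` of total mass `d ≥ 1` is at most the sum over a finset
of size `d` carrying the largest values. -/
theorem sum_mul_weight_le_sum_top {n : Type*} [Fintype n] [DecidableEq n] (f w : n → ℝ)
    (T : Finset n) (hT : T.Nonempty) (htop : ∀ i ∈ T, ∀ j ∉ T, f j ≤ f i)
    (h0 : ∀ i, 0 ≤ w i) (h1 : ∀ i, w i ≤ 1) (hw : ∑ i, w i = T.card) :
    ∑ i, f i * w i ≤ ∑ i ∈ T, f i := by
  obtain ⟨m, hm, hmin⟩ := T.exists_min_image f hT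
  have key : ∀ i, (f i - f m) * w i ≤ if i ∈ T then f i - f m else 0 := by
    intro i
    split_ifs with hi
    · exact mul_le_of_le_one_right (sub_nonneg.mpr (hmin i hi)) (h1 i)
    · exact mul_nonpos_of_nonpos_of_nonneg (sub_nonpos.mpr (htop m hm i hi)) (h0 i)
  have hsum := Finset.sum_le_sum fun i (_ : i ∈ Finset.univ) => key i
  rw [Finset.sum_ite_mem, Finset.univ_inter, Finset.sum_sub_distrib, Finset.sum_const,
    nsmul_eq_mul] at hsum
  simp only [sub_mul, Finset.sum_sub_distrib, ← Finset.mul_sum, hw] at hsum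
  linarith [mul_comm (f m) (T.card : ℝ)]

/-- Spectral decomposition of a Hermitian matrix into rank-one projections. -/
theorem Matrix.IsHermitian.eq_sum_smul_outer {n : Type*} [Fintype n] [DecidableEq n]
    {A : Matrix n n ℂ} (hA : A.IsHermitian) :
    A = ∑ i, (hA.eigenvalues i : ℂ) • outer (hA.eigenvectorBasis i) := by
  conv_lhs => rw [hA.spectral_theorem, Unitary.conjStarAlgAut_apply]
  ext a b
  simp only [mul_apply, diagonal_apply, Function.comp_apply, Matrix.sum_apply, Matrix.smul_apply,
    outer, smul_eq_mul, mul_ite, mul_zero, Finset.sum_ite_eq', Finset.mem_univ, if_true,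
    Matrix.star_apply, Matrix.IsHermitian.eigenvectorUnitary_apply]
  refine Finset.sum_congr rfl fun i _ => ?_
  simp
  ring

theorem star_dotProduct_outer_mulVec {n : Type*} [Fintype n] (e u : EuclideanSpace ℂ n) :
    star (u : n → ℂ) ⬝ᵥ outer e *ᵥ u = ((‖inner ℂ u e‖ ^ 2 : ℝ) : ℂ) := by
  have h : outer (e : n → ℂ) = vecMulVec e (star (e : n → ℂ)) := rfl
  have h' : star (e : n → ℂ) ⬝ᵥ u = star (inner ℂ u e) := by
    rw [EuclideanSpace.inner_eq_star_dotProduct, star_dotProduct, dotProduct_comm]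
  rw [h, vecMulVec_mulVec, dotProduct_smul, h', dotProduct_comm,
    ← EuclideanSpace.inner_eq_star_dotProduct]
  rw [op_smul_eq_smul, smul_eq_mul, RCLike.star_def, mul_comm, Complex.mul_conj,
    Complex.normSq_eq_norm_sq]

theorem Matrix.IsHermitian.re_star_dotProduct_mulVec {n : Type*} [Fintype n] [DecidableEq n]
    {A : Matrix n n ℂ} (hA : A.IsHermitian) (u : EuclideanSpace ℂ n) :
    (star (u : n → ℂ) ⬝ᵥ A *ᵥ u).re =
      ∑ j, hA.eigenvalues j * ‖inner ℂ u (hA.eigenvectorBasis j)‖ ^ 2 := by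
  conv_lhs => rw [hA.eq_sum_smul_outer]
  simp only [sum_mulVec, dotProduct_sum, smul_mulVec, dotProduct_smul,
    star_dotProduct_outer_mulVec, smul_eq_mul, Complex.re_sum, ← Complex.ofReal_mul,
    Complex.ofReal_re]

/-- **Ky Fan's inequality**. -/
theorem sum_re_star_dotProduct_le_sumTopEigs {n ι : Type*} [Fintype n] [DecidableEq n]
    {A : Matrix n n ℂ} (hA : A.IsHermitian) {u : ι → EuclideanSpace ℂ n}
    (hu : Orthonormal ℂ u) (T : Finset ι) (hT : 1 ≤ T.card) (hTn : T.card ≤ Fintype.card n) :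
    ∑ i ∈ T, (star (u i : n → ℂ) ⬝ᵥ A *ᵥ (u i)).re ≤ sumTopEigs hA T.card := by
  obtain ⟨T', hcard, hsum, htop⟩ := exists_top_finset hA.eigenvalues hTn
  simp only [hA.re_star_dotProduct_mulVec]
  rw [Finset.sum_comm]
  simp only [← Finset.mul_sum]
  refine (sum_mul_weight_le_sum_top _ _ T' (Finset.card_pos.mp (by omega)) htop
    (fun j => Finset.sum_nonneg fun i _ => sq_nonneg _) (fun j => ?_) ?_).trans_eq hsum
  · simpa using hu.sum_inner_products_le (hA.eigenvectorBasis j) (s := T)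
  · rw [Finset.sum_comm, hcard]
    simp [OrthonormalBasis.sum_sq_norm_inner_left, hu.1]

theorem exists_sumTopEigs_eq {n : Type*} [Fintype n] [DecidableEq n]
    {A : Matrix n n ℂ} (hA : A.IsHermitian) {d : ℕ} (hd : d ≤ Fintype.card n) :
    ∃ T : Finset n, T.card = d ∧ sumTopEigs hA d =
      ∑ i ∈ T, (star (hA.eigenvectorBasis i : n → ℂ) ⬝ᵥ A *ᵥ (hA.eigenvectorBasis i)).re := by
  obtain ⟨T, hcard, hsum, -⟩ := exists_top_finset hA.eigenvalues hd
  exact ⟨T, hcard, hsum.symm.trans (Finset.sum_congr rfl fun i _ => hA.eigenvalues_eq i)⟩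

/-- Convexity of the sum of the `d` largest eigenvalues. -/
theorem sumTopEigs_sum_smul_le {n κ : Type*} [Fintype n] [DecidableEq n] [Fintype κ]
    {A : Matrix n n ℂ} (hA : A.IsHermitian) {B : κ → Matrix n n ℂ} (hB : ∀ k, (B k).IsHermitian)
    {p : κ → ℝ} (hp : ∀ k, 0 ≤ p k) (hAB : A = ∑ k, (p k : ℂ) • B k) {d : ℕ} (hd1 : 1 ≤ d)
    (hd : d ≤ Fintype.card n) :
    sumTopEigs hA d ≤ ∑ k, p k * sumTopEigs (hB k) d := by
  obtain ⟨T, rfl, hsum⟩ := exists_sumTopEigs_eq hA hd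
  have hq (v : n → ℂ) : (star v ⬝ᵥ A *ᵥ v).re = ∑ k, p k * (star v ⬝ᵥ B k *ᵥ v).re := by
    simp only [hAB, sum_mulVec, dotProduct_sum, smul_mulVec, dotProduct_smul, smul_eq_mul,
      Complex.re_sum, Complex.re_ofReal_mul]
  rw [hsum]
  simp only [hq]
  rw [Finset.sum_comm]
  simp only [← Finset.mul_sum]
  exact Finset.sum_le_sum fun k _ => mul_le_mul_of_nonneg_left
    (sum_re_star_dotProduct_le_sumTopEigs (hB k) hA.eigenvectorBasis.orthonormal T hd1 hd) (hp k)

theorem Matrix.IsHermitian.sum_eigenvalues_eq_one {n : Type*} [Fintype n] [DecidableEq n]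
    {A : Matrix n n ℂ} (hA : A.IsHermitian) (htr : A.trace = 1) :
    ∑ i, hA.eigenvalues i = 1 := by
  apply Complex.ofReal_injective
  have h := hA.trace_eq_sum_eigenvalues
  rw [htr] at h
  simpa using h.symm

theorem epsD_nonneg {n : Type*} [Fintype n] [DecidableEq n] {A : Matrix n n ℂ}
    (hA : A.PosSemidef) (htr : A.trace = 1) {d : ℕ} (hd : d ≤ Fintype.card n) :
    0 ≤ epsD A d := by
  obtain ⟨T, -, hsum, -⟩ := exists_top_finset hA.isHermitian.eigenvalues hd
  have htr' := hA.isHermitian.sum_eigenvalues_eq_one htr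
  rw [epsD, dif_pos hA.isHermitian, sub_nonneg, sumTopEigs, ← hsum, ← htr']
  exact Finset.sum_le_sum_of_subset_of_nonneg (Finset.subset_univ _)
    fun i _ _ => hA.eigenvalues_nonneg i

theorem ptraceR_outer_posSemidef {S R : Type*} [Fintype S] [Fintype R] (ψ : S × R → ℂ) :
    (ptraceR (outer ψ)).PosSemidef := by
  have h : ptraceR (outer ψ) =
      ∑ r, vecMulVec (fun s => ψ (s, r)) (star fun s => ψ (s, r)) := by
    ext s s'
    simp [ptraceR, outer, vecMulVec_apply, Matrix.sum_apply]
  rw [h]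
  exact posSemidef_sum _ fun r _ => posSemidef_vecMulVec_self_star _

theorem trace_ptraceR_outer {S R : Type*} [Fintype S] [Fintype R] (ψ : S × R → ℂ) :
    (ptraceR (outer ψ)).trace = star ψ ⬝ᵥ ψ := by
  simp [Matrix.trace, ptraceR, outer, dotProduct, Fintype.sum_prod_type, mul_comm]

theorem ptraceR_sum_smul {S R κ : Type*} [Fintype R] [Fintype κ]
    (c : κ → ℂ) (M : κ → Matrix (S × R) (S × R) ℂ) :
    ptraceR (∑ k, c k • M k) = ∑ k, c k • ptraceR (M k) := by
  ext s s'
  simp only [ptraceR, Matrix.sum_apply, Matrix.smul_apply, smul_eq_mul, Finset.mul_sum]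
  exact Finset.sum_comm

theorem bddBelow_convRoof_values {S R : Type*} [Fintype S] [Fintype R] [DecidableEq S] {d : ℕ}
    (hd : d ≤ Fintype.card S) (ρ : Matrix (S × R) (S × R) ℂ) :
    BddBelow { e : ℝ | ∃ (m : ℕ) (p : Fin m → ℝ) (ψ : Fin m → (S × R → ℂ)),
      (∀ k, 0 ≤ p k) ∧ (∑ k, p k = 1) ∧
      (∀ k, star (ψ k) ⬝ᵥ ψ k = 1) ∧
      (ρ = ∑ k, (p k : ℂ) • outer (ψ k)) ∧
      e = ∑ k, p k * epsD (ptraceR (outer (ψ k))) d } := by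
  refine ⟨0, ?_⟩
  rintro e ⟨m, p, ψ, hp, -, hψ, -, rfl⟩
  exact Finset.sum_nonneg fun k _ => mul_nonneg (hp k)
    (epsD_nonneg (ptraceR_outer_posSemidef _) ((trace_ptraceR_outer _).trans (hψ k)) hd)

/-- for a density matrix `ρ` on `(S×R)×(S×R)` and `1 ≤ d ≤ |S|`,
`E^(d)_{S|R}(ρ) ≤ ε^(d)(tr_R ρ)`. -/
theorem stmt8 {S R : Type*} [Fintype S] [Fintype R] [DecidableEq S] [DecidableEq R]
    [Nonempty S] [Nonempty R]
    (ρ : Matrix (S × R) (S × R) ℂ) (hρ : ρ.PosSemidef) (htr : ρ.trace = 1)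
    (d : ℕ) (hd1 : 1 ≤ d) (hdn : d ≤ Fintype.card S) :
    convRoofE d ρ ≤ epsD (ptraceR ρ) d := by
  set φ := (Fintype.equivFin (S × R)).symm
  set p : Fin (Fintype.card (S × R)) → ℝ := fun k => hρ.isHermitian.eigenvalues (φ k)
  set ψ : Fin (Fintype.card (S × R)) → (S × R → ℂ) :=
    fun k => hρ.isHermitian.eigenvectorBasis (φ k)
  have hp (k) : 0 ≤ p k := hρ.eigenvalues_nonneg _
  have hp1 : ∑ k, p k = 1 := by
    rw [φ.sum_comp hρ.isHermitian.eigenvalues]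
    exact hρ.isHermitian.sum_eigenvalues_eq_one htr
  have hψ (k) : star (ψ k) ⬝ᵥ ψ k = 1 := by
    rw [dotProduct_comm, ← EuclideanSpace.inner_eq_star_dotProduct]
    simp
  have hdec : ρ = ∑ k, (p k : ℂ) • outer (ψ k) := by
    rw [φ.sum_comp fun i => (hρ.isHermitian.eigenvalues i : ℂ) •
      outer (hρ.isHermitian.eigenvectorBasis i)]
    exact hρ.isHermitian.eq_sum_smul_outer
  refine (csInf_le (bddBelow_convRoof_values hdn ρ) ⟨_, p, ψ, hp, hp1, hψ, hdec, rfl⟩).trans ?_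
  have hB (k) : (ptraceR (outer (ψ k))).IsHermitian := (ptraceR_outer_posSemidef _).isHermitian
  have hAB : ptraceR ρ = ∑ k, (p k : ℂ) • ptraceR (outer (ψ k)) := by
    conv_lhs => rw [hdec, ptraceR_sum_smul]
  have hA : (ptraceR ρ).IsHermitian := by
    ext s s'
    simp only [conjTranspose_apply, ptraceR, star_sum]
    exact Finset.sum_congr rfl fun r _ => hρ.isHermitian.apply _ _
  have h := sumTopEigs_sum_smul_le hA hB hp hAB hd1 hdn
  simp only [epsD, dif_pos hA, dif_pos (hB _), mul_sub, mul_one, Finset.sum_sub_distrib, hp1]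
  linarith
end
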